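/- Every n-vertex d-regular graph with d even has a (d/2)-cohesive set of at most ⌈n/2⌉ vertices, i.e., a nonempty set S with |S| ≤ ⌈n/2⌉ such that every vertex of S has at least d/2 neighbors in S. -/

import Mathlib

open Finset

open scoped Classical in
noncomputable def degIn {V : Type*} (G : SimpleGraph V) [DecidableRel G.Adj] (S : Finset V) (x : V) : ℕ :=
  (S.filter fun y => G.Adj x y).card

lemma degIn_eq_sum {V : Type*} (G : SimpleGraph V) [DecidableRel G.Adj] (S : Finset V) (x : V) :
    degIn G S x = ∑ y ∈ S, if G.Adj x y then 1 else 0 := by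
  classical
  unfold degIn
  rw [Finset.card_filter]

/-- number of edges between `S` and its complement -/
noncomputable def cutSize {V : Type*} [Fintype V] [DecidableEq V] (G : SimpleGraph V)
    [DecidableRel G.Adj] (S : Finset V) : ℕ := ∑ x ∈ S, degIn G Sᶜ x

lemma cutSize_compl {V : Type*} [Fintype V] [DecidableEq V] (G : SimpleGraph V)
    [DecidableRel G.Adj] (S : Finset V) : cutSize G Sᶜ = cutSize G S := by
  simp only [cutSize, degIn_eq_sum, compl_compl]
  rw [Finset.sum_comm]
  simp only [G.adj_comm]

lemma degIn_insert {V : Type*} [DecidableEq V] (G : SimpleGraph V)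
    [DecidableRel G.Adj] (S : Finset V) (a x : V) (ha : a ∉ S) :
    degIn G (insert a S) x = (if G.Adj x a then 1 else 0) + degIn G S x := by
  simp only [degIn_eq_sum]
  rw [Finset.sum_insert ha]

lemma cutSize_erase {V : Type*} [Fintype V] [DecidableEq V] (G : SimpleGraph V)
    [DecidableRel G.Adj] (A : Finset V) (a : V) (ha : a ∈ A) :
    cutSize G (A.erase a) + degIn G Aᶜ a = cutSize G A + degIn G A a := by
  have h1 : ∑ x ∈ A.erase a, (if G.Adj x a then 1 else 0) = degIn G A a := by
    rw [degIn_eq_sum, ← Finset.add_sum_erase A _ ha]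
    simp [G.adj_comm]
  have h2 := Finset.sum_erase_add A (fun x => degIn G Aᶜ x) ha
  have h3 : cutSize G (A.erase a) = degIn G A a + ∑ x ∈ A.erase a, degIn G Aᶜ x := by
    rw [← h1, ← Finset.sum_add_distrib]
    unfold cutSize
    refine Finset.sum_congr rfl fun x _ => ?_
    rw [Finset.compl_erase, degIn_insert _ _ _ _ (by simpa using ha)]
  have h4 : cutSize G A = ∑ x ∈ A, degIn G Aᶜ x := rfl
  omega

lemma degIn_add_compl {V : Type*} [Fintype V] [DecidableEq V] (G : SimpleGraph V)
    [DecidableRel G.Adj] (d : ℕ) (hreg : G.IsRegularOfDegree d) (A : Finset V) (a : V) :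
    degIn G A a + degIn G Aᶜ a = d := by
  rw [degIn_eq_sum, degIn_eq_sum, Finset.sum_add_sum_compl, ← hreg a,
    ← G.card_neighborFinset_eq_degree, SimpleGraph.neighborFinset_eq_filter, Finset.card_filter]

/-- Every d-regular graph with d even has a (d/2)-cohesive set of at most ⌈n/2⌉ vertices. -/
theorem cohesive_set_even {V : Type*} [Fintype V] [DecidableEq V] [Nonempty V]
    (G : SimpleGraph V) [DecidableRel G.Adj] (d : ℕ) (hreg : G.IsRegularOfDegree d) (hd : Even d) :
    ∃ S : Finset V, S.Nonempty ∧ S.card ≤ (Fintype.card V + 1) / 2 ∧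
      ∀ x ∈ S, d / 2 ≤ degIn G S x := by
  obtain ⟨k, rfl⟩ := hd
  have hn : 0 < Fintype.card V := Fintype.card_pos
  obtain ⟨A, hA, hmin⟩ := Finset.exists_min_image
    (Finset.powersetCard ((Fintype.card V + 1) / 2) (Finset.univ : Finset V)) (cutSize G)
    (Finset.powersetCard_nonempty.2 (by rw [Finset.card_univ]; omega))
  simp only [Finset.mem_powersetCard, Finset.subset_univ, true_and] at hA hmin
  by_contra! hcon
  obtain ⟨a, ha, hda⟩ := hcon A (Finset.card_pos.1 (by omega)) hA.le
  have e1 := cutSize_erase G A a ha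
  have r1 := degIn_add_compl G _ hreg A a
  have hcA := Finset.card_compl A
  have haC : a ∉ Aᶜ := by simpa using ha
  have hc : cutSize G (insert a Aᶜ) = cutSize G (A.erase a) := by
    rw [← Finset.compl_erase, cutSize_compl]
  have hcard : (insert a Aᶜ).card = Aᶜ.card + 1 := Finset.card_insert_of_notMem haC
  rcases Nat.even_or_odd' (Fintype.card V) with ⟨m, hm | hm⟩
  · obtain ⟨b, hb, hdb⟩ := hcon Aᶜ (Finset.card_pos.1 (by omega)) (by omega)
    have hbC : b ∈ insert a Aᶜ := Finset.mem_insert_of_mem hb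
    have e2 := cutSize_erase G _ b hbC
    have r2 := degIn_add_compl G _ hreg (insert a Aᶜ) b
    have i2 := degIn_insert G Aᶜ a b haC
    have := hmin ((insert a Aᶜ).erase b) (by rw [Finset.card_erase_of_mem hbC]; omega)
    split_ifs at i2 <;> omega
  · have := hmin (insert a Aᶜ) (by omega)
    omega
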